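/- Let A be an associative unital algebra over a field k. For any integers i, j, k ≥ 1, one has [[M_i(A), M_j(A)], M_k(A)] ⊆ M_{i+j+k-3}(A), where [X,Y] denotes the linear span of commutators [x,y] = xy − yx with x ∈ X, y ∈ Y. -/

import Mathlib

noncomputable section

/-- `lcs k A n` is the `(n+1)`-st term `L_{n+1}(A)` of the lower central series of `A`
regarded as a Lie algebra under the commutator `[a,b] = a*b - b*a`:
`lcs k A 0 = L_1(A) = A` and `L_{n+2}(A) = span [A, L_{n+1}(A)]`. -/
def lcs (k A : Type*) [Field k] [Ring A] [Algebra k A] : ℕ → Submodule k A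
  | 0 => ⊤
  | n + 1 => Submodule.span k {x | ∃ a : A, ∃ b ∈ lcs k A n, x = a * b - b * a}

/-- `Lser k A i = L_i(A)` for `i ≥ 1`. -/
def Lser (k A : Type*) [Field k] [Ring A] [Algebra k A] (i : ℕ) : Submodule k A :=
  lcs k A (i - 1)

/-- The two-sided ideal of `A` generated by a set `S`, as a `k`-submodule. -/
def idealGen (k : Type*) {A : Type*} [Field k] [Ring A] [Algebra k A] (S : Set A) :
    Submodule k A :=
  Submodule.span k {x | ∃ a b : A, ∃ s ∈ S, x = a * s * b}

/-- `Mser k A i = M_i(A)`, the two-sided ideal of `A` generated by `L_i(A)`. -/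
def Mser (k A : Type*) [Field k] [Ring A] [Algebra k A] (i : ℕ) : Submodule k A :=
  idealGen k (Lser k A i : Set A)

/-- The span of commutators `[x, y] = x*y - y*x` with `x ∈ X`, `y ∈ Y`. -/
def submoduleBracket (k : Type*) {A : Type*} [Field k] [Ring A] [Algebra k A]
    (X Y : Submodule k A) : Submodule k A :=
  Submodule.span k {z | ∃ x ∈ X, ∃ y ∈ Y, z = x * y - y * x}
section LowerCentralSeries

variable {k A : Type*} [Field k] [Ring A] [Algebra k A]

theorem bracket_mem_lcs_succ {n : ℕ} (a : A) {b : A} (hb : b ∈ lcs k A n) :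
    a * b - b * a ∈ lcs k A (n + 1) :=
  Submodule.subset_span ⟨a, b, hb, rfl⟩

theorem bracket_mem_lcs_succ' {n : ℕ} (a : A) {b : A} (hb : b ∈ lcs k A n) :
    b * a - a * b ∈ lcs k A (n + 1) := by
  rw [← neg_sub]
  exact neg_mem (bracket_mem_lcs_succ a hb)

theorem mem_lcs_zero (a : A) : a ∈ lcs k A 0 := Submodule.mem_top

theorem lcs_succ_le (n : ℕ) : lcs k A (n + 1) ≤ lcs k A n := by
  induction n with
  | zero => exact le_top
  | succ n ih =>
    refine Submodule.span_le.2 ?_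
    rintro _ ⟨a, b, hb, rfl⟩
    exact bracket_mem_lcs_succ a (ih hb)

theorem lcs_antitone : Antitone (lcs k A) := antitone_nat_of_succ_le lcs_succ_le

/-- `[L_{p+1}, L_{q+1}] ⊆ L_{p+q+2}`. -/
theorem bracket_mem_lcs (p : ℕ) : ∀ (q : ℕ) {x y : A}, x ∈ lcs k A p → y ∈ lcs k A q →
    x * y - y * x ∈ lcs k A (p + q + 1) := by
  induction p with
  | zero =>
    intro q x y _ hy
    rw [Nat.zero_add]
    exact bracket_mem_lcs_succ x hy
  | succ p ih =>
    intro q x y hx hy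
    induction hx using Submodule.span_induction with
    | mem x hx =>
      obtain ⟨a, b, hb, rfl⟩ := hx
      have h₁ := bracket_mem_lcs_succ a (ih q hb hy)
      have h₂ := ih (q + 1) hb (bracket_mem_lcs_succ a hy)
      rw [show p + (q + 1) + 1 = p + q + 1 + 1 by ring] at h₂
      rw [show p + 1 + q + 1 = p + q + 1 + 1 by ring]
      convert sub_mem h₁ h₂ using 1
      noncomm_ring
    | zero => simp
    | add x₁ x₂ _ _ h₁ h₂ =>
      convert add_mem h₁ h₂ using 1
      noncomm_ring
    | smul c x _ h =>
      convert Submodule.smul_mem _ c h using 1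
      rw [smul_mul_assoc, mul_smul_comm, smul_sub]

/-- The iterated commutator `[x₁, [x₂, … [xᵣ, y]]]`. -/
def iterBracket (X : List A) (y : A) : A := X.foldr (fun x z => x * z - z * x) y

theorem iterBracket_cons (x : A) (X : List A) (y : A) :
    iterBracket (x :: X) y = x * iterBracket X y - iterBracket X y * x := rfl

theorem iterBracket_add (X : List A) (y z : A) :
    iterBracket X (y + z) = iterBracket X y + iterBracket X z := by
  induction X with
  | nil => rfl
  | cons x X ih =>
    simp only [iterBracket_cons, ih]
    noncomm_ring

theorem iterBracket_mem_lcs (X : List A) {n : ℕ} {y : A} (hy : y ∈ lcs k A n) :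
    iterBracket X y ∈ lcs k A (n + X.length) := by
  induction X with
  | nil => exact hy
  | cons x X ih => exact bracket_mem_lcs_succ x ih

theorem lcs_succ_eq_span_iterBracket (n : ℕ) :
    lcs k A (n + 1) = Submodule.span k
      {z | ∃ (X : List A) (a b : A), X.length = n ∧ z = iterBracket X (a * b - b * a)} := by
  apply le_antisymm
  · induction n with
    | zero =>
      refine Submodule.span_le.2 ?_
      rintro _ ⟨a, b, -, rfl⟩
      exact Submodule.subset_span ⟨[], a, b, rfl, rfl⟩
    | succ n ih =>
      refine Submodule.span_le.2 ?_
      rintro _ ⟨a, b, hb, rfl⟩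
      replace hb := ih hb
      induction hb using Submodule.span_induction with
      | mem x hx =>
        obtain ⟨X, c, d, rfl, rfl⟩ := hx
        exact Submodule.subset_span ⟨a :: X, c, d, rfl, rfl⟩
      | zero => simp
      | add x₁ x₂ _ _ h₁ h₂ =>
        rw [SetLike.mem_coe] at h₁ h₂ ⊢
        convert add_mem h₁ h₂ using 1
        noncomm_ring
      | smul c x _ h =>
        rw [SetLike.mem_coe] at h ⊢
        convert Submodule.smul_mem _ c h using 1
        rw [smul_mul_assoc, mul_smul_comm, smul_sub]
  · refine Submodule.span_le.2 ?_
    rintro _ ⟨X, a, b, rfl, rfl⟩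
    rw [Nat.add_comm, SetLike.mem_coe]
    exact iterBracket_mem_lcs X (bracket_mem_lcs_succ a (mem_lcs_zero b))

/-- The span of the products `y * z` and `z * y` with `y ∈ L_{a+1}`, `z ∈ L_{b+1}`, `a + b = n`
and `a < m`. -/
def lcsProducts (k A : Type*) [Field k] [Ring A] [Algebra k A] (n m : ℕ) : Submodule k A :=
  Submodule.span k {x | ∃ a b, a < m ∧ a + b = n ∧ ∃ y ∈ lcs k A a, ∃ z ∈ lcs k A b,
    x = y * z ∨ x = z * y}

theorem mul_mem_lcsProducts {n m a b : ℕ} (ha : a < m) (hn : a + b = n) {y z : A}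
    (hy : y ∈ lcs k A a) (hz : z ∈ lcs k A b) : y * z ∈ lcsProducts k A n m :=
  Submodule.subset_span ⟨a, b, ha, hn, y, hy, z, hz, Or.inl rfl⟩

theorem mul_mem_lcsProducts' {n m a b : ℕ} (ha : a < m) (hn : a + b = n) {y z : A}
    (hy : y ∈ lcs k A a) (hz : z ∈ lcs k A b) : z * y ∈ lcsProducts k A n m :=
  Submodule.subset_span ⟨a, b, ha, hn, y, hy, z, hz, Or.inr rfl⟩

theorem bracket_mem_lcsProducts {n m : ℕ} (c : A) {x : A} (hx : x ∈ lcsProducts k A n m) :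
    c * x - x * c ∈ lcsProducts k A (n + 1) (m + 1) := by
  induction hx using Submodule.span_induction with
  | mem x hx =>
    obtain ⟨a, b, ha, hn, y, hy, z, hz, rfl | rfl⟩ := hx
    · have h₁ : (c * y - y * c) * z ∈ lcsProducts k A (n + 1) (m + 1) :=
        mul_mem_lcsProducts (by omega) (by omega) (bracket_mem_lcs_succ c hy) hz
      have h₂ : y * (c * z - z * c) ∈ lcsProducts k A (n + 1) (m + 1) :=
        mul_mem_lcsProducts (by omega) (by omega) hy (bracket_mem_lcs_succ c hz)
      convert add_mem h₁ h₂ using 1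
      noncomm_ring
    · have h₁ : z * (c * y - y * c) ∈ lcsProducts k A (n + 1) (m + 1) :=
        mul_mem_lcsProducts' (by omega) (by omega) (bracket_mem_lcs_succ c hy) hz
      have h₂ : (c * z - z * c) * y ∈ lcsProducts k A (n + 1) (m + 1) :=
        mul_mem_lcsProducts' (by omega) (by omega) hy (bracket_mem_lcs_succ c hz)
      convert add_mem h₁ h₂ using 1
      noncomm_ring
  | zero => simp
  | add x₁ x₂ _ _ h₁ h₂ =>
    convert add_mem h₁ h₂ using 1
    noncomm_ring
  | smul r x _ h =>
    convert Submodule.smul_mem _ r h using 1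
    rw [smul_mul_assoc, mul_smul_comm, smul_sub]

theorem iterBracket_mem_lcsProducts (X : List A) {n m : ℕ} {x : A}
    (hx : x ∈ lcsProducts k A n m) :
    iterBracket X x ∈ lcsProducts k A (n + X.length) (m + X.length) := by
  induction X with
  | nil => exact hx
  | cons c X ih => exact bracket_mem_lcsProducts c ih

theorem iterBracket_mul_sub_mem_lcsProducts (X : List A) {p q : ℕ} {y z : A}
    (hy : y ∈ lcs k A p) (hz : z ∈ lcs k A q) :
    iterBracket X (y * z) - iterBracket X y * z ∈
      lcsProducts k A (p + q + X.length) (p + X.length) := by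
  induction X with
  | nil => simp [iterBracket]
  | cons c X ih =>
    have h₁ := bracket_mem_lcsProducts c ih
    have h₂ : iterBracket X y * (c * z - z * c) ∈
        lcsProducts k A (p + q + X.length + 1) (p + X.length + 1) :=
      mul_mem_lcsProducts (Nat.lt_succ_self _) (by ring) (iterBracket_mem_lcs X hy)
        (bracket_mem_lcs_succ c hz)
    rw [List.length_cons, ← Nat.add_assoc, ← Nat.add_assoc]
    convert add_mem h₁ h₂ using 1
    simp only [iterBracket_cons]
    noncomm_ring

theorem mul_mul_mem_idealGen {S : Set A} (a b : A) {x : A} (hx : x ∈ idealGen k S) :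
    a * x * b ∈ idealGen k S := by
  induction hx using Submodule.span_induction with
  | mem x hx =>
    obtain ⟨c, d, s, hs, rfl⟩ := hx
    exact Submodule.subset_span ⟨a * c, d * b, s, hs, by noncomm_ring⟩
  | zero => simp
  | add x₁ x₂ _ _ h₁ h₂ =>
    convert add_mem h₁ h₂ using 1
    noncomm_ring
  | smul c x _ h =>
    convert Submodule.smul_mem _ c h using 1
    rw [mul_smul_comm, smul_mul_assoc]

theorem mul_left_mem_idealGen {S : Set A} (a : A) {x : A} (hx : x ∈ idealGen k S) :
    a * x ∈ idealGen k S := by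
  simpa using mul_mul_mem_idealGen a 1 hx

theorem mul_right_mem_idealGen {S : Set A} (b : A) {x : A} (hx : x ∈ idealGen k S) :
    x * b ∈ idealGen k S := by
  simpa using mul_mul_mem_idealGen 1 b hx

theorem mem_idealGen_of_mem {S : Set A} {x : A} (hx : x ∈ S) : x ∈ idealGen k S :=
  Submodule.subset_span ⟨1, 1, x, hx, by simp⟩

theorem idealGen_mono {S T : Set A} (h : S ⊆ T) : idealGen k S ≤ idealGen k T :=
  Submodule.span_mono fun _ ⟨a, b, s, hs, hx⟩ => ⟨a, b, s, h hs, hx⟩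

/-- The two-sided ideal `M_{n+1}(A)` generated by `L_{n+1}(A)`. -/
abbrev lcsIdeal (k A : Type*) [Field k] [Ring A] [Algebra k A] (n : ℕ) : Submodule k A :=
  idealGen k (lcs k A n : Set A)

theorem lcsIdeal_antitone : Antitone (lcsIdeal k A) :=
  fun _ _ h => idealGen_mono (lcs_antitone h)

theorem mem_lcsIdeal_of_le {m n : ℕ} (h : m ≤ n) {x : A} (hx : x ∈ lcs k A n) :
    x ∈ lcsIdeal k A m :=
  lcsIdeal_antitone h (mem_idealGen_of_mem hx)

theorem lcsIdeal_eq_span (n : ℕ) :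
    lcsIdeal k A n = Submodule.span k {x | ∃ a : A, ∃ l ∈ lcs k A n, x = a * l} := by
  apply le_antisymm
  · refine Submodule.span_le.2 ?_
    rintro _ ⟨a, b, l, hl, rfl⟩
    have h₁ : a * b * l ∈ Submodule.span k {x | ∃ a : A, ∃ l ∈ lcs k A n, x = a * l} :=
      Submodule.subset_span ⟨a * b, l, hl, rfl⟩
    have h₂ : a * (l * b - b * l) ∈
        Submodule.span k {x | ∃ a : A, ∃ l ∈ lcs k A n, x = a * l} :=
      Submodule.subset_span ⟨a, _, lcs_succ_le n (bracket_mem_lcs_succ' b hl), rfl⟩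
    rw [SetLike.mem_coe]
    convert add_mem h₁ h₂ using 1
    noncomm_ring
  · refine Submodule.span_le.2 ?_
    rintro _ ⟨a, l, hl, rfl⟩
    exact mul_left_mem_idealGen a (mem_idealGen_of_mem hl)

theorem mul_mem_lcsIdeal_of_mem_lcs (p : ℕ) : ∀ (q : ℕ) {y z : A}, y ∈ lcs k A p →
    z ∈ lcs k A q → y * z ∈ lcsIdeal k A (p + q - 1) := by
  induction p using Nat.strong_induction_on with
  | _ p ih =>
  intro q y z hy hz
  obtain _ | p := p
  · exact mul_left_mem_idealGen y (mem_lcsIdeal_of_le (by omega) hz)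
  obtain _ | q := q
  · exact mul_right_mem_idealGen z (mem_lcsIdeal_of_le (by omega) hy)
  have products_le : lcsProducts k A (p + 1 + (q + 1)) (p + 1) ≤
      lcsIdeal k A (p + 1 + (q + 1) - 1) := by
    refine Submodule.span_le.2 ?_
    rintro _ ⟨a, b, ha, hab, u, hu, v, hv, rfl | rfl⟩
    · rw [← hab]
      exact ih a ha b hu hv
    · have h₁ := ih a ha b hu hv
      have h₂ : u * v - v * u ∈ lcsIdeal k A (a + b - 1) :=
        mem_lcsIdeal_of_le (by omega) (bracket_mem_lcs a b hu hv)
      rw [← hab, SetLike.mem_coe]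
      convert sub_mem h₁ h₂ using 1
      noncomm_ring
  rw [lcs_succ_eq_span_iterBracket] at hy
  induction hy using Submodule.span_induction with
  | mem y hy =>
    obtain ⟨X, d, e, rfl, rfl⟩ := hy
    induction hz using Submodule.span_induction with
    | mem z hz =>
      obtain ⟨b, v, hv, rfl⟩ := hz
      have hde : d * e - e * d ∈ lcs k A 1 := bracket_mem_lcs_succ d (mem_lcs_zero e)
      set y := d * e - e * d
      have h₁ : iterBracket X (y * b * v - v * (y * b)) ∈
          lcsIdeal k A (X.length + 1 + (q + 1) - 1) :=
        mem_lcsIdeal_of_le (by omega) (iterBracket_mem_lcs X (bracket_mem_lcs_succ (y * b) hv))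
      have h₂ : iterBracket X (y * (b * v - v * b)) - iterBracket X y * (b * v - v * b) ∈
          lcsIdeal k A (X.length + 1 + (q + 1) - 1) := by
        apply products_le
        have := iterBracket_mul_sub_mem_lcsProducts X hde (bracket_mem_lcs_succ b hv)
        rwa [show 1 + (q + 1) + X.length = X.length + 1 + (q + 1) by ring,
          Nat.add_comm 1 X.length] at this
      have h₃ : iterBracket X ((y * v - v * y) * b) ∈
          lcsIdeal k A (X.length + 1 + (q + 1) - 1) := by
        apply products_le
        have := iterBracket_mem_lcsProducts X (mul_mem_lcsProducts' (k := k) (n := 1 + q + 1)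
          Nat.zero_lt_one (Nat.zero_add _) (mem_lcs_zero b) (bracket_mem_lcs 1 q hde hv))
        rwa [show 1 + q + 1 + X.length = X.length + 1 + (q + 1) by ring,
          Nat.add_comm 1 X.length] at this
      have leibniz : y * b * v - v * (y * b) = y * (b * v - v * b) + (y * v - v * y) * b := by
        noncomm_ring
      rw [leibniz, iterBracket_add] at h₁
      convert sub_mem (sub_mem h₁ h₃) h₂ using 1
      abel
    | zero => simp
    | add x₁ x₂ _ _ h₁ h₂ =>
      rw [mul_add]
      exact add_mem h₁ h₂
    | smul c x _ h =>
      rw [mul_smul_comm]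
      exact Submodule.smul_mem _ c h
  | zero => simp
  | add x₁ x₂ _ _ h₁ h₂ =>
    rw [add_mul]
    exact add_mem h₁ h₂
  | smul c x _ h =>
    rw [smul_mul_assoc]
    exact Submodule.smul_mem _ c h

/-- `M_{p+1} M_{q+1} ⊆ M_{p+q}`. -/
theorem mul_mem_lcsIdeal {p q n : ℕ} (hn : n ≤ p + q - 1) {x y : A} (hx : x ∈ lcsIdeal k A p)
    (hy : y ∈ lcsIdeal k A q) : x * y ∈ lcsIdeal k A n := by
  apply lcsIdeal_antitone hn
  rw [lcsIdeal_eq_span] at hx hy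
  induction hx using Submodule.span_induction with
  | mem x hx =>
    obtain ⟨a, l, hl, rfl⟩ := hx
    induction hy using Submodule.span_induction with
    | mem y hy =>
      obtain ⟨b, l', hl', rfl⟩ := hy
      have h₁ := mul_left_mem_idealGen (a * b) (mul_mem_lcsIdeal_of_mem_lcs p q hl hl')
      have h₂ := mul_left_mem_idealGen a
        (mul_mem_lcsIdeal_of_mem_lcs p q (lcs_succ_le p (bracket_mem_lcs_succ' b hl)) hl')
      convert add_mem h₁ h₂ using 1
      noncomm_ring
    | zero => simp
    | add x₁ x₂ _ _ h₁ h₂ =>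
      rw [mul_add]
      exact add_mem h₁ h₂
    | smul c x _ h =>
      rw [mul_smul_comm]
      exact Submodule.smul_mem _ c h
  | zero => simp
  | add x₁ x₂ _ _ h₁ h₂ =>
    rw [add_mul]
    exact add_mem h₁ h₂
  | smul c x _ h =>
    rw [smul_mul_assoc]
    exact Submodule.smul_mem _ c h

theorem bracket_mem_lcsIdeal {p q n : ℕ} (hn : n ≤ p + q - 1) {x y : A}
    (hx : x ∈ lcsIdeal k A p) (hy : y ∈ lcsIdeal k A q) : x * y - y * x ∈ lcsIdeal k A n :=
  sub_mem (mul_mem_lcsIdeal hn hx hy) (mul_mem_lcsIdeal (by omega) hy hx)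

theorem bracket_mul_sub_mem_lcsIdeal {p q : ℕ} (a b : A) {x y : A} (hx : x ∈ lcs k A p)
    (hy : y ∈ lcs k A q) :
    a * x * (b * y) - b * y * (a * x) - (a * b - b * a) * x * y ∈ lcsIdeal k A (p + q) := by
  have hxy : x * y - y * x ∈ lcsIdeal k A (p + q) :=
    mem_lcsIdeal_of_le (Nat.le_succ _) (bracket_mem_lcs p q hx hy)
  have h₁ := mul_left_mem_idealGen (a * b - b * a) hxy
  have h₂ : (a * y - y * a) * x ∈ lcsIdeal k A (p + q) :=
    mul_mem_lcsIdeal (by omega) (mem_idealGen_of_mem (bracket_mem_lcs_succ a hy))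
      (mem_idealGen_of_mem hx)
  have h₃ : (x * b - b * x) * y ∈ lcsIdeal k A (p + q) :=
    mul_mem_lcsIdeal (by omega) (mem_idealGen_of_mem (bracket_mem_lcs_succ' b hx))
      (mem_idealGen_of_mem hy)
  convert add_mem (add_mem (sub_mem (mul_left_mem_idealGen b h₂) h₁)
    (mul_left_mem_idealGen (a * b) hxy)) (mul_left_mem_idealGen a h₃) using 1
  noncomm_ring

theorem bracket_commutator_mul_mem_lcsIdeal {p q m : ℕ} (a b c : A) {x y z : A}
    (hx : x ∈ lcs k A p) (hy : y ∈ lcs k A q) (hz : z ∈ lcs k A m) :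
    (a * b - b * a) * x * y * (c * z) - c * z * ((a * b - b * a) * x * y) ∈
      lcsIdeal k A (p + q + m - 1) := by
  have hw : a * b - b * a ∈ lcs k A 1 := bracket_mem_lcs_succ a (mem_lcs_zero b)
  generalize a * b - b * a = w at hw
  have gen {n : ℕ} {u : A} (hu : u ∈ lcs k A n) : u ∈ lcsIdeal k A n := mem_idealGen_of_mem hu
  have h₁ : (w * c - c * w) * z * x * y ∈ lcsIdeal k A (p + q + m - 1) :=
    mul_mem_lcsIdeal (p := m + p) (by omega)
      (mul_mem_lcsIdeal (p := m + 1) (by omega)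
        (mul_mem_lcsIdeal (by omega) (gen (bracket_mem_lcs_succ' c hw)) (gen hz))
        (gen hx)) (gen hy)
  have h₂ : (w * z - z * w) * x * y ∈ lcsIdeal k A (p + q + m - 1) :=
    mul_mem_lcsIdeal (p := m + p + 1) (by omega)
      (mul_mem_lcsIdeal (by omega) (gen (bracket_mem_lcs 1 m hw hz)) (gen hx)) (gen hy)
  have hwx : w * x ∈ lcsIdeal k A p := mul_left_mem_idealGen w (gen hx)
  have h₃ : w * x * (y * c - c * y) * z ∈ lcsIdeal k A (p + q + m - 1) :=
    mul_mem_lcsIdeal (p := p + q) (by omega)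
      (mul_mem_lcsIdeal (by omega) hwx (gen (bracket_mem_lcs_succ' c hy))) (gen hz)
  have h₄ : w * x * (c * (y * z - z * y)) ∈ lcsIdeal k A (p + q + m - 1) :=
    mul_mem_lcsIdeal (by omega) hwx
      (mul_left_mem_idealGen c (gen (bracket_mem_lcs q m hy hz)))
  have h₅ : w * (x * c - c * x) * z * y ∈ lcsIdeal k A (p + q + m - 1) :=
    mul_mem_lcsIdeal (p := p + m) (by omega)
      (mul_mem_lcsIdeal (p := p + 1) (by omega)
        (mul_left_mem_idealGen w (gen (bracket_mem_lcs_succ' c hx))) (gen hz)) (gen hy)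
  have h₆ : w * (c * (x * z - z * x)) * y ∈ lcsIdeal k A (p + q + m - 1) :=
    mul_mem_lcsIdeal (by omega)
      (mul_left_mem_idealGen w (mul_left_mem_idealGen c (gen (bracket_mem_lcs p m hx hz))))
      (gen hy)
  convert add_mem (add_mem (add_mem h₁ (mul_left_mem_idealGen c h₂)) (add_mem h₃ h₄))
    (add_mem h₅ h₆) using 1
  noncomm_ring

theorem bracket_bracket_mem_lcsIdeal {p q m : ℕ} {x y z : A} (hx : x ∈ lcsIdeal k A p)
    (hy : y ∈ lcsIdeal k A q) (hz : z ∈ lcsIdeal k A m) :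
    (x * y - y * x) * z - z * (x * y - y * x) ∈ lcsIdeal k A (p + q + m - 1) := by
  rw [lcsIdeal_eq_span] at hx hy hz
  induction hx using Submodule.span_induction with
  | mem x hx =>
    induction hy using Submodule.span_induction with
    | mem y hy =>
      induction hz using Submodule.span_induction with
      | mem z hz =>
        obtain ⟨a, x, hx, rfl⟩ := hx
        obtain ⟨b, y, hy, rfl⟩ := hy
        obtain ⟨c, z, hz, rfl⟩ := hz
        have h₁ := bracket_mem_lcsIdeal (Nat.le_refl _) (bracket_mul_sub_mem_lcsIdeal a b hx hy)
          (mul_left_mem_idealGen c (mem_idealGen_of_mem hz))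
        have h₂ := bracket_commutator_mul_mem_lcsIdeal a b c hx hy hz
        convert add_mem h₁ h₂ using 1
        noncomm_ring
      | zero => simp
      | add x₁ x₂ _ _ h₁ h₂ =>
        convert add_mem h₁ h₂ using 1
        noncomm_ring
      | smul c x _ h =>
        convert Submodule.smul_mem _ c h using 1
        simp only [smul_mul_assoc, mul_smul_comm, smul_sub]
    | zero => simp
    | add x₁ x₂ _ _ h₁ h₂ =>
      convert add_mem h₁ h₂ using 1
      noncomm_ring
    | smul c x _ h =>
      convert Submodule.smul_mem _ c h using 1
      simp only [smul_mul_assoc, mul_smul_comm, smul_sub, sub_mul, mul_sub]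
  | zero => simp
  | add x₁ x₂ _ _ h₁ h₂ =>
    convert add_mem h₁ h₂ using 1
    noncomm_ring
  | smul c x _ h =>
    convert Submodule.smul_mem _ c h using 1
    simp only [smul_mul_assoc, mul_smul_comm, smul_sub, sub_mul, mul_sub]

end LowerCentralSeries

/-- For any associative unital algebra `A` over a field `k` and any `i, j, m ≥ 1`, one has
`[[M_i(A), M_j(A)], M_m(A)] ⊆ M_{i+j+m-3}(A)`. -/
theorem bracket_bracket_Mser_le (k A : Type*) [Field k] [Ring A] [Algebra k A]
    (i j m : ℕ) (hi : 1 ≤ i) (hj : 1 ≤ j) (hm : 1 ≤ m) :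
    submoduleBracket k (submoduleBracket k (Mser k A i) (Mser k A j)) (Mser k A m) ≤
      Mser k A (i + j + m - 3) := by
  have index : i + j + m - 3 - 1 = i - 1 + (j - 1) + (m - 1) - 1 := by omega
  refine Submodule.span_le.2 ?_
  rintro _ ⟨w, hw, z, hz, rfl⟩
  rw [SetLike.mem_coe, Mser, Lser, index]
  induction hw using Submodule.span_induction with
  | mem w hw =>
    obtain ⟨x, hx, y, hy, rfl⟩ := hw
    exact bracket_bracket_mem_lcsIdeal hx hy hz
  | zero => simp
  | add x₁ x₂ _ _ h₁ h₂ =>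
    convert add_mem h₁ h₂ using 1
    noncomm_ring
  | smul c x _ h =>
    convert Submodule.smul_mem _ c h using 1
    rw [smul_mul_assoc, mul_smul_comm, smul_sub]
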